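/- arXiv:1704.05954 — 2 statements merged into one kernel-verified Lean document; each statement's English description precedes it below -/
import Mathlib

section
/- For all λ > 0 and R > 0, ∫₀^R √(2λ) · e^{−λπz²/2} · (2/√π) · (∫₀^{√(πλ(R² − z²)/2)} e^{−t²} dt) dz = 1 − e^{−λπR²/2}. Equivalently, the function f(z) = √(2λ) e^{−λπz²/2} erf(√(πλ(R² − z²)/2)) / (1 − e^{−λπR²/2}), with erf(x) = (2/√π)∫₀^x e^{−t²} dt, is a probability density on [0, R]. -/
open Real MeasureTheory

/-- The open quarter disk of radius `S` in the first quadrant. -/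
def quarterDisk (S : ℝ) : Set (ℝ × ℝ) :=
  {p | 0 < p.1 ∧ 0 < p.2 ∧ p.1 ^ 2 + p.2 ^ 2 < S ^ 2}

theorem measurableSet_quarterDisk (S : ℝ) : MeasurableSet (quarterDisk S) := by
  refine IsOpen.measurableSet ?_
  exact (isOpen_lt continuous_const continuous_fst).inter
    ((isOpen_lt continuous_const continuous_snd).inter
      (isOpen_lt (f := fun p : ℝ × ℝ => p.1 ^ 2 + p.2 ^ 2) (by fun_prop) continuous_const))

theorem quarterDisk_subset {S : ℝ} (hS : 0 < S) :
    quarterDisk S ⊆ Set.Icc 0 S ×ˢ Set.Icc 0 S := by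
  rintro ⟨x, y⟩ ⟨hx, hy, h⟩
  simp only at hx hy h
  exact ⟨⟨hx.le, by dsimp only; nlinarith⟩, ⟨hy.le, by dsimp only; nlinarith⟩⟩

theorem integrable_indicator_quarterDisk {S : ℝ} (hS : 0 < S) {g : ℝ × ℝ → ℝ}
    (hg : Continuous g) : Integrable ((quarterDisk S).indicator g) := by
  rw [integrable_indicator_iff (measurableSet_quarterDisk S)]
  exact (hg.continuousOn.integrableOn_compact (isCompact_Icc.prod isCompact_Icc)).mono_set
    (quarterDisk_subset hS)

theorem mk_mem_quarterDisk_iff {S x y : ℝ} (hS : 0 < S) :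
    (x, y) ∈ quarterDisk S ↔ x ∈ Set.Ioo 0 S ∧ y ∈ Set.Ioo 0 (√(S ^ 2 - x ^ 2)) := by
  simp only [quarterDisk, Set.mem_ofPred_eq, Set.mem_Ioo]
  constructor
  · rintro ⟨hx, hy, h⟩
    exact ⟨⟨hx, by nlinarith⟩, hy, (lt_sqrt hy.le).2 (by linarith)⟩
  · rintro ⟨⟨hx, -⟩, hy, h⟩
    exact ⟨hx, hy, by linarith [(lt_sqrt hy.le).1 h]⟩

theorem polarCoord_symm_mem_quarterDisk_iff {S : ℝ} (hS : 0 < S) {p : ℝ × ℝ}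
    (hp : p ∈ polarCoord.target) :
    polarCoord.symm p ∈ quarterDisk S ↔ p ∈ Set.Ioo 0 S ×ˢ Set.Ioo 0 (π / 2) := by
  obtain ⟨r, θ⟩ := p
  obtain ⟨hr, hθ₁, hθ₂⟩ := hp
  simp only [Set.mem_Ioi] at hr hθ₁ hθ₂
  have hsq : (r * cos θ) ^ 2 + (r * sin θ) ^ 2 = r ^ 2 := by
    linear_combination r ^ 2 * cos_sq_add_sin_sq θ
  simp only [polarCoord_symm_apply, quarterDisk, Set.mem_ofPred_eq, Set.mem_prod, Set.mem_Ioo, hsq,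
    mul_pos_iff_of_pos_left hr, hr, true_and, sq_lt_sq₀ hr.le hS.le]
  constructor
  · rintro ⟨hc, hs, h⟩
    refine ⟨h, ?_, ?_⟩
    · by_contra! hle
      exact absurd (sin_nonpos_of_nonpos_of_neg_pi_le hle hθ₁.le) (not_le.2 hs)
    · by_contra! hle
      exact absurd (cos_nonpos_of_pi_div_two_le_of_le hle (by linarith)) (not_le.2 hc)
  · rintro ⟨h, h₁, h₂⟩
    exact ⟨cos_pos_of_mem_Ioo ⟨by linarith, h₂⟩, sin_pos_of_pos_of_lt_pi h₁ hθ₂, h⟩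

theorem integral_mul_exp_neg_sq (S : ℝ) :
    ∫ r in (0 : ℝ)..S, r * exp (-r ^ 2) = (1 - exp (-S ^ 2)) / 2 := by
  have h : ∀ r : ℝ, HasDerivAt (fun r => -exp (-r ^ 2) / 2) (r * exp (-r ^ 2)) r := by
    intro r
    refine (((hasDerivAt_pow 2 r).fun_neg.exp).fun_neg.div_const 2).congr_deriv ?_
    push_cast
    ring
  rw [intervalIntegral.integral_eq_sub_of_hasDerivAt (fun r _ => h r)
    (Continuous.intervalIntegrable (by fun_prop) _ _)]
  simp
  ring

theorem integral_quarterDisk_exp_polar {S : ℝ} (hS : 0 < S) :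
    ∫ p, (quarterDisk S).indicator (fun p : ℝ × ℝ => exp (-(p.1 ^ 2 + p.2 ^ 2))) p =
      π / 4 * (1 - exp (-S ^ 2)) := by
  rw [← integral_comp_polarCoord_symm]
  have hsub : Set.Ioo 0 S ×ˢ Set.Ioo 0 (π / 2) ⊆ polarCoord.target := by
    rintro ⟨r, θ⟩ ⟨hr, hθ⟩
    exact ⟨hr.1, by have := hθ.1; have := pi_pos; dsimp only at *; linarith,
      by have := hθ.2; have := pi_pos; dsimp only at *; linarith⟩
  have hmeas : MeasurableSet (Set.Ioo 0 S ×ˢ Set.Ioo 0 (π / 2)) :=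
    measurableSet_Ioo.prod measurableSet_Ioo
  have hcongr : Set.EqOn
      (fun p : ℝ × ℝ => p.1 • (quarterDisk S).indicator
        (fun p : ℝ × ℝ => exp (-(p.1 ^ 2 + p.2 ^ 2))) (polarCoord.symm p))
      ((Set.Ioo 0 S ×ˢ Set.Ioo 0 (π / 2)).indicator
        fun p : ℝ × ℝ => p.1 * exp (-p.1 ^ 2) * 1) polarCoord.target := by
    intro p hp
    have hiff := polarCoord_symm_mem_quarterDisk_iff hS hp
    by_cases hmem : p ∈ Set.Ioo 0 S ×ˢ Set.Ioo 0 (π / 2)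
    · have hsq : (p.1 * cos p.2) ^ 2 + (p.1 * sin p.2) ^ 2 = p.1 ^ 2 := by
        linear_combination p.1 ^ 2 * cos_sq_add_sin_sq p.2
      simp only [Set.indicator_of_mem hmem, Set.indicator_of_mem (hiff.2 hmem)]
      simp [polarCoord_symm_apply, hsq]
    · simp only [Set.indicator_of_notMem hmem, Set.indicator_of_notMem (mt hiff.1 hmem), smul_zero]
  rw [setIntegral_congr_fun polarCoord.open_target.measurableSet hcongr,
    setIntegral_indicator hmeas, Set.inter_eq_right.2 hsub, Measure.volume_eq_prod,
    setIntegral_prod_mul (fun r => r * exp (-r ^ 2)) (fun _ => (1 : ℝ)),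
    ← integral_Ioc_eq_integral_Ioo, ← intervalIntegral.integral_of_le hS.le,
    integral_mul_exp_neg_sq]
  simp only [setIntegral_const, measureReal_def, Real.volume_Ioo, sub_zero, smul_eq_mul, mul_one,
    ENNReal.toReal_ofReal pi_div_two_pos.le]
  ring

theorem integral_exp_neg_sq_mul_integral_exp_neg_sq {S : ℝ} (hS : 0 < S) :
    ∫ x in (0 : ℝ)..S, exp (-x ^ 2) * ∫ y in (0 : ℝ)..√(S ^ 2 - x ^ 2), exp (-y ^ 2) =
      π / 4 * (1 - exp (-S ^ 2)) := by
  rw [← integral_quarterDisk_exp_polar hS, Measure.volume_eq_prod,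
    integral_prod _ (integrable_indicator_quarterDisk hS (by fun_prop)),
    intervalIntegral.integral_of_le hS.le, integral_Ioc_eq_integral_Ioo,
    ← integral_indicator measurableSet_Ioo]
  congr 1 with x
  by_cases hx : x ∈ Set.Ioo 0 S
  · rw [Set.indicator_of_mem hx, intervalIntegral.integral_of_le (sqrt_nonneg _),
      integral_Ioc_eq_integral_Ioo, ← integral_const_mul, ← integral_indicator measurableSet_Ioo]
    congr 1 with y
    have hiff := mk_mem_quarterDisk_iff (x := x) (y := y) hS
    by_cases hy : y ∈ Set.Ioo 0 (√(S ^ 2 - x ^ 2))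
    · rw [Set.indicator_of_mem hy, Set.indicator_of_mem (hiff.2 ⟨hx, hy⟩), neg_add, exp_add]
    · rw [Set.indicator_of_notMem hy, Set.indicator_of_notMem fun h => hy (hiff.1 h).2]
  · simp [mk_mem_quarterDisk_iff hS, hx]

/-- The NFP forward-progress density integrates to `1 - e^{-λπR²/2}` on `[0, R]`:
`∫₀^R √(2λ) e^{-λπz²/2} erf(√(πλ(R²-z²)/2)) dz = 1 - e^{-λπR²/2}`,
with `erf(x) = (2/√π) ∫₀^x e^{-t²} dt`. -/
theorem nfp_forward_progress_normalization (lam R : ℝ) (hlam : 0 < lam) (hR : 0 < R) :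
    ∫ z in (0 : ℝ)..R,
        Real.sqrt (2 * lam) * Real.exp (-(lam * Real.pi * z ^ 2 / 2)) *
          ((2 / Real.sqrt Real.pi) *
            ∫ t in (0 : ℝ)..Real.sqrt (Real.pi * lam * (R ^ 2 - z ^ 2) / 2),
              Real.exp (-t ^ 2)) =
      1 - Real.exp (-(lam * Real.pi * R ^ 2 / 2)) := by
  obtain ⟨c, hc, hc2⟩ : ∃ c : ℝ, 0 < c ∧ c ^ 2 = lam * π / 2 :=
    ⟨√(lam * π / 2), by positivity, sq_sqrt (by positivity)⟩
  have hconst : √(2 * lam) * (2 / √π) = 4 / π * c := by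
    have hpi := pi_pos
    rw [← sq_eq_sq₀ (by positivity) (by positivity)]
    simp only [mul_pow, div_pow, sq_sqrt hpi.le, sq_sqrt (show 0 ≤ 2 * lam by positivity), hc2]
    field_simp
    norm_num
  have hcongr : ∀ z : ℝ,
      √(2 * lam) * exp (-(lam * π * z ^ 2 / 2)) *
          (2 / √π * ∫ t in (0 : ℝ)..√(π * lam * (R ^ 2 - z ^ 2) / 2), exp (-t ^ 2)) =
        4 / π * (c * (exp (-(c * z) ^ 2) *
          ∫ t in (0 : ℝ)..√((c * R) ^ 2 - (c * z) ^ 2), exp (-t ^ 2))) := by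
    intro z
    have h₁ : π * lam * (R ^ 2 - z ^ 2) / 2 = (c * R) ^ 2 - (c * z) ^ 2 := by
      linear_combination (z ^ 2 - R ^ 2) * hc2
    have h₂ : lam * π * z ^ 2 / 2 = (c * z) ^ 2 := by linear_combination -z ^ 2 * hc2
    rw [h₁, h₂, mul_mul_mul_comm, hconst]
    ring
  have h₃ : lam * π * R ^ 2 / 2 = (c * R) ^ 2 := by linear_combination -R ^ 2 * hc2
  simp only [hcongr]
  rw [intervalIntegral.integral_const_mul, intervalIntegral.integral_const_mul,
    intervalIntegral.mul_integral_comp_mul_left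
      (f := fun x => exp (-x ^ 2) * ∫ t in (0 : ℝ)..√((c * R) ^ 2 - x ^ 2), exp (-t ^ 2)),
    mul_zero, integral_exp_neg_sq_mul_integral_exp_neg_sq (by positivity), h₃]
  field_simp
end

section
/- For all λ > 0 and R > 0, ∫₀^R ∫_{−π/2}^{π/2} λ r · exp(−λR²(arccos((r cos θ)/R) − ((r cos θ)/R)·√(1 − ((r cos θ)/R)²))) dθ dr = 1 − e^{−λπR²/2}. Equivalently, the function f(r) = ∫_{−π/2}^{π/2} λ r e^{−λR²(arccos((r cos θ)/R) − ((r cos θ)/R)√(1 − ((r cos θ)/R)²))} dθ / (1 − e^{−λπR²/2}) is a probability density on [0, R]. -/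
open Real MeasureTheory

/-- The half-disk `{x > 0, x² + y² < R²}` integral of a function of `x` alone, in Cartesian
coordinates. -/
lemma integral_halfDisk_cartesian (g : ℝ → ℝ) (hg : Continuous g) {R : ℝ} (hR : 0 < R) :
    ∫ p : ℝ × ℝ, Set.indicator {p : ℝ × ℝ | 0 < p.1 ∧ p.1 ^ 2 + p.2 ^ 2 < R ^ 2}
        (fun p => g p.1) p =
      ∫ x in (0 : ℝ)..R, 2 * √(R ^ 2 - x ^ 2) * g x := by
  have hS : MeasurableSet {p : ℝ × ℝ | 0 < p.1 ∧ p.1 ^ 2 + p.2 ^ 2 < R ^ 2} :=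
    ((isOpen_lt continuous_const continuous_fst).and
      (isOpen_lt (f := fun p : ℝ × ℝ => p.1 ^ 2 + p.2 ^ 2) (by fun_prop)
        continuous_const)).measurableSet
  have hint : Integrable (Set.indicator {p : ℝ × ℝ | 0 < p.1 ∧ p.1 ^ 2 + p.2 ^ 2 < R ^ 2}
      (fun p => g p.1)) := by
    rw [integrable_indicator_iff hS]
    have hc : IntegrableOn (fun p : ℝ × ℝ => g p.1) (Set.Icc (-R) R ×ˢ Set.Icc (-R) R) :=
      (hg.comp continuous_fst).continuousOn.integrableOn_compact
        (isCompact_Icc.prod isCompact_Icc)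
    refine hc.mono_set ?_
    rintro ⟨x, y⟩ ⟨_, h⟩
    have hx : |x| ≤ R := abs_le_of_sq_le_sq (by nlinarith [sq_nonneg y]) hR.le
    have hy : |y| ≤ R := abs_le_of_sq_le_sq (by nlinarith [sq_nonneg x]) hR.le
    exact ⟨abs_le.1 hx, abs_le.1 hy⟩
  rw [Measure.volume_eq_prod] at hint ⊢
  rw [integral_prod _ hint, intervalIntegral.integral_of_le hR.le,
    ← integral_indicator measurableSet_Ioc]
  congr 1
  ext x
  by_cases hx : x ∈ Set.Ioc 0 R
  · have hslice : ∀ y : ℝ, Set.indicator {p : ℝ × ℝ | 0 < p.1 ∧ p.1 ^ 2 + p.2 ^ 2 < R ^ 2}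
        (fun p => g p.1) (x, y) =
        Set.indicator (Set.Ioo (-√(R ^ 2 - x ^ 2)) (√(R ^ 2 - x ^ 2))) (fun _ => g x) y := by
      intro y
      have : (x, y) ∈ {p : ℝ × ℝ | 0 < p.1 ∧ p.1 ^ 2 + p.2 ^ 2 < R ^ 2} ↔
          y ∈ Set.Ioo (-√(R ^ 2 - x ^ 2)) (√(R ^ 2 - x ^ 2)) := by
        rw [Set.mem_Ioo, ← Real.sq_lt, lt_sub_iff_add_lt']
        exact and_iff_right hx.1
      simp only [Set.indicator_apply, this]
    have hpos : 0 ≤ √(R ^ 2 - x ^ 2) + √(R ^ 2 - x ^ 2) := by positivity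
    simp only [hslice, Set.indicator_of_mem hx]
    rw [integral_indicator measurableSet_Ioo, setIntegral_const, Real.volume_real_Ioo_of_le
      (by linarith), smul_eq_mul]
    ring
  · rw [Set.indicator_of_notMem hx]
    have hslice : ∀ y : ℝ, Set.indicator {p : ℝ × ℝ | 0 < p.1 ∧ p.1 ^ 2 + p.2 ^ 2 < R ^ 2}
        (fun p => g p.1) (x, y) = 0 := by
      intro y
      refine Set.indicator_of_notMem ?_ _
      rintro ⟨h0, h⟩
      exact hx ⟨h0, (abs_le.1 (abs_le_of_sq_le_sq (by nlinarith [sq_nonneg y]) hR.le)).2⟩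
    simp [hslice]

/-- The half-disk `{x > 0, x² + y² < R²}` integral of a function of `x` alone, in polar
coordinates. -/
lemma integral_halfDisk_polar (g : ℝ → ℝ) (hg : Continuous g) {R : ℝ} (hR : 0 < R) :
    ∫ p : ℝ × ℝ, Set.indicator {p : ℝ × ℝ | 0 < p.1 ∧ p.1 ^ 2 + p.2 ^ 2 < R ^ 2}
        (fun p => g p.1) p =
      ∫ r in (0 : ℝ)..R, ∫ θ in (-(π / 2))..(π / 2), r * g (r * cos θ) := by
  have hpi := Real.pi_pos
  have hmem : ∀ p ∈ polarCoord.target,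
      (polarCoord.symm p ∈ {p : ℝ × ℝ | 0 < p.1 ∧ p.1 ^ 2 + p.2 ^ 2 < R ^ 2} ↔
        p ∈ Set.Ioo 0 R ×ˢ Set.Ioo (-(π / 2)) (π / 2)) := by
    rintro ⟨r, θ⟩ ⟨hr, hθ⟩
    simp only [Set.mem_Ioi, Set.mem_Ioo] at hr hθ
    have hnorm : (r * cos θ) ^ 2 + (r * sin θ) ^ 2 = r ^ 2 := by
      linear_combination r ^ 2 * Real.sin_sq_add_cos_sq θ
    simp only [polarCoord_symm_apply, Set.mem_ofPred_eq, hnorm, Set.mem_prod, Set.mem_Ioo,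
      mul_pos_iff_of_pos_left hr, sq_lt_sq₀ hr.le hR.le]
    constructor
    · rintro ⟨hcos, hrR⟩
      refine ⟨⟨hr, hrR⟩, ?_, ?_⟩
      · by_contra! h
        have := Real.cos_nonpos_of_pi_div_two_le_of_le (x := -θ) (by linarith) (by linarith)
        rw [Real.cos_neg] at this
        linarith
      · by_contra! h
        have := Real.cos_nonpos_of_pi_div_two_le_of_le (x := θ) h (by linarith)
        linarith
    · rintro ⟨⟨-, hrR⟩, hθ'⟩
      exact ⟨Real.cos_pos_of_mem_Ioo hθ', hrR⟩
  have hsub : Set.Ioo 0 R ×ˢ Set.Ioo (-(π / 2)) (π / 2) ⊆ polarCoord.target := by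
    rintro ⟨r, θ⟩ ⟨hr, hθ⟩
    exact ⟨hr.1, by linarith [hθ.1], by linarith [hθ.2]⟩
  have hint : IntegrableOn (fun p : ℝ × ℝ => p.1 * g (p.1 * cos p.2))
      (Set.Ioo 0 R ×ˢ Set.Ioo (-(π / 2)) (π / 2)) := by
    have hc : Continuous (fun p : ℝ × ℝ => p.1 * g (p.1 * cos p.2)) := by fun_prop
    exact (hc.continuousOn.integrableOn_compact (isCompact_Icc.prod isCompact_Icc)).mono_set
      (Set.prod_mono Set.Ioo_subset_Icc_self Set.Ioo_subset_Icc_self)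
  rw [← integral_comp_polarCoord_symm,
    setIntegral_eq_of_subset_of_forall_sdiff_eq_zero polarCoord.open_target.measurableSet hsub
      (fun p hp => by
        rw [Set.indicator_of_notMem (fun h => hp.2 ((hmem p hp.1).1 h)), smul_zero]),
    setIntegral_congr_fun (g := fun p : ℝ × ℝ => p.1 * g (p.1 * cos p.2))
      (measurableSet_Ioo.prod measurableSet_Ioo)
      (fun p hp => by
        beta_reduce
        rw [Set.indicator_of_mem ((hmem p (hsub hp)).2 hp), smul_eq_mul,
          polarCoord_symm_apply])]
  rw [Measure.volume_eq_prod] at hint ⊢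
  rw [setIntegral_prod _ hint, intervalIntegral.integral_of_le hR.le, integral_Ioc_eq_integral_Ioo]
  simp only [intervalIntegral.integral_of_le (show -(π / 2) ≤ π / 2 by linarith),
    integral_Ioc_eq_integral_Ioo]

/-- The derivative of the area of the unit circular segment is minus the chord length. -/
lemma hasDerivAt_arccos_sub_mul_sqrt {u : ℝ} (hu : u ∈ Set.Ioo (-1) 1) :
    HasDerivAt (fun u => arccos u - u * √(1 - u ^ 2)) (-(2 * √(1 - u ^ 2))) u := by
  have hpos : 0 < 1 - u ^ 2 := by nlinarith [hu.1, hu.2]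
  have hsqrt : HasDerivAt (fun u : ℝ => √(1 - u ^ 2)) (-(2 * u) / (2 * √(1 - u ^ 2))) u := by
    simpa using ((hasDerivAt_pow 2 u).const_sub 1).sqrt hpos.ne'
  refine ((Real.hasDerivAt_arccos hu.1.ne' hu.2.ne).sub
    ((hasDerivAt_id u).mul hsqrt)).congr_deriv ?_
  have hs : 0 < √(1 - u ^ 2) := Real.sqrt_pos.2 hpos
  have hsq : √(1 - u ^ 2) ^ 2 = 1 - u ^ 2 := Real.sq_sqrt hpos.le
  simp only [id]
  field_simp
  linear_combination hsq

/-- The MFR transmitter–relay distance density integrates to `1 - e^{-λπR²/2}`: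
`∫₀^R ∫_{-π/2}^{π/2} λ r e^{-λR²(arccos((r cos θ)/R) - ((r cos θ)/R)√(1-((r cos θ)/R)²))} dθ dr
 = 1 - e^{-λπR²/2}`. -/
theorem mfr_distance_normalization (lam R : ℝ) (hlam : 0 < lam) (hR : 0 < R) :
    ∫ r in (0 : ℝ)..R,
        ∫ θ in (-(Real.pi / 2))..(Real.pi / 2),
          lam * r *
            Real.exp (-(lam * R ^ 2 *
              (Real.arccos ((r * Real.cos θ) / R) -
                ((r * Real.cos θ) / R) *
                  Real.sqrt (1 - ((r * Real.cos θ) / R) ^ 2)))) =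
      1 - Real.exp (-(lam * Real.pi * R ^ 2 / 2)) := by
  set G : ℝ → ℝ := fun x => exp (-(lam * R ^ 2 * (arccos (x / R) - x / R * √(1 - (x / R) ^ 2))))
    with hG
  have hGc : Continuous G := by
    have := Real.continuous_arccos
    fun_prop
  have hderiv : ∀ x ∈ Set.Ioo 0 R,
      HasDerivAt G (2 * √(R ^ 2 - x ^ 2) * (lam * G x)) x := by
    intro x hx
    have hu : x / R ∈ Set.Ioo (-1) 1 :=
      ⟨by linarith [div_pos hx.1 hR], (div_lt_one hR).2 hx.2⟩
    have hchord : √(R ^ 2 - x ^ 2) = R * √(1 - (x / R) ^ 2) := by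
      rw [show R ^ 2 - x ^ 2 = R ^ 2 * (1 - (x / R) ^ 2) by field_simp,
        Real.sqrt_mul (sq_nonneg R), Real.sqrt_sq hR.le]
    have harea := (hasDerivAt_arccos_sub_mul_sqrt hu).comp x ((hasDerivAt_id x).div_const R)
    refine ((harea.const_mul (lam * R ^ 2)).neg.exp).congr_deriv ?_
    simp only [hchord, hG, Function.comp_apply, id, Pi.neg_apply]
    field_simp
  have hftc : ∫ x in (0 : ℝ)..R, 2 * √(R ^ 2 - x ^ 2) * (lam * G x) = G R - G 0 :=
    intervalIntegral.integral_eq_sub_of_hasDerivAt_of_le hR.le hGc.continuousOn hderiv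
      (Continuous.intervalIntegrable (by fun_prop) _ _)
  have hend : G R - G 0 = 1 - exp (-(lam * π * R ^ 2 / 2)) := by
    simp only [hG, div_self hR.ne', zero_div, Real.arccos_one, Real.arccos_zero]
    norm_num
    ring
  rw [← hend, ← hftc, ← integral_halfDisk_cartesian (fun x => lam * G x) (by fun_prop) hR,
    integral_halfDisk_polar (fun x => lam * G x) (by fun_prop) hR]
  simp only [hG, mul_left_comm, mul_assoc]
end
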